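/- arXiv:1802.01467 — 3 statements merged into one kernel-verified Lean document; each statement's English description precedes it below -/
import Mathlib

section
/- The function f̃ : ℝ × ℝ³ → ℂ defined by f̃(t, x) = 1/(‖x‖² − (t − i)²) is well defined (the denominator never vanishes) and satisfies the wave equation ∂²f̃/∂t²(t, x) = ∑_{j=1}^{3} ∂²f̃/∂x_j²(t, x) for all (t, x) ∈ ℝ × ℝ³. -/
/-- Partial derivative in the `j`-th spatial coordinate. -/
noncomputable def pd {F : Type*} [NormedAddCommGroup F] [NormedSpace ℝ F]
    (j : Fin 3) (f : (Fin 3 → ℝ) → F) (x : Fin 3 → ℝ) : F :=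
  deriv (fun s => f (Function.update x j s)) (x j)

/-- Partial derivative in the time variable of a time-dependent field. -/
noncomputable def pdt {F : Type*} [NormedAddCommGroup F] [NormedSpace ℝ F]
    (f : ℝ → (Fin 3 → ℝ) → F) (t : ℝ) (x : Fin 3 → ℝ) : F :=
  deriv (fun s => f s x) t

/-- The seed function `f̃(t,x) = 1/(‖x‖² − (t−i)²)`. -/
noncomputable def ftilde (t : ℝ) (x : Fin 3 → ℝ) : ℂ :=
  1 / (((∑ j : Fin 3, (x j) ^ 2 : ℝ) : ℂ) - ((t : ℂ) - Complex.I) ^ 2)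

theorem den_ne (t : ℝ) (x : Fin 3 → ℝ) :
    (((∑ j : Fin 3, (x j) ^ 2 : ℝ) : ℂ) - ((t : ℂ) - Complex.I) ^ 2) ≠ 0 := by
  intro h
  have h1 := congrArg Complex.re h
  have h2 := congrArg Complex.im h
  have hs : 0 ≤ ∑ j : Fin 3, (x j) ^ 2 := Finset.sum_nonneg fun _ _ => sq_nonneg _
  generalize (∑ j : Fin 3, (x j) ^ 2) = S at *
  simp [pow_two] at h1 h2
  have ht : t = 0 := by linarith
  subst ht
  norm_num at h1
  linarith

theorem second_deriv (c a e : ℂ) (h : ∀ s : ℝ, c + e * ((s : ℂ) + a) ^ 2 ≠ 0) (t : ℝ) :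
    deriv (deriv (fun s : ℝ => 1 / (c + e * ((s : ℂ) + a) ^ 2))) t =
      -2 * e / (c + e * ((t : ℂ) + a) ^ 2) ^ 2
        + 8 * e ^ 2 * ((t : ℂ) + a) ^ 2 / (c + e * ((t : ℂ) + a) ^ 2) ^ 3 := by
  have hl : ∀ s : ℝ, HasDerivAt (fun s : ℝ => (s : ℂ) + a) 1 s := fun s =>
    (HasDerivAt.ofReal_comp (hasDerivAt_id s)).add_const a |>.congr_deriv (by simp)
  have hD : ∀ s : ℝ, HasDerivAt (fun s : ℝ => c + e * ((s : ℂ) + a) ^ 2)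
      (2 * e * ((s : ℂ) + a)) s := fun s =>
    ((((hl s).fun_pow 2).const_mul e).const_add c).congr_deriv (by norm_num; ring)
  have h1 : deriv (fun s : ℝ => 1 / (c + e * ((s : ℂ) + a) ^ 2)) =
      fun s : ℝ => (-2 * e * ((s : ℂ) + a)) / (c + e * ((s : ℂ) + a) ^ 2) ^ 2 := by
    funext s
    refine (((hasDerivAt_const s (1 : ℂ)).fun_div (hD s) (h s)).congr_deriv ?_).deriv
    ring
  rw [h1]
  refine ((((hl t).const_mul (-2 * e)).fun_div ((hD t).fun_pow 2)
    (pow_ne_zero 2 (h t))).congr_deriv ?_).deriv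
  have := h t
  generalize hX : c + e * ((t : ℂ) + a) ^ 2 = X at *
  field_simp
  norm_num
  ring

theorem pd_pd (j : Fin 3) (f : (Fin 3 → ℝ) → ℂ) (x : Fin 3 → ℝ) :
    pd j (pd j f) x = deriv (deriv (fun s => f (Function.update x j s))) (x j) := by
  unfold pd
  simp only [Function.update_idem, Function.update_self]

theorem space_deriv (j : Fin 3) (t : ℝ) (x : Fin 3 → ℝ) :
    pd j (pd j (ftilde t)) x =
      -2 / (((∑ j : Fin 3, (x j) ^ 2 : ℝ) : ℂ) - ((t : ℂ) - Complex.I) ^ 2) ^ 2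
        + 8 * (x j : ℂ) ^ 2 /
          (((∑ j : Fin 3, (x j) ^ 2 : ℝ) : ℂ) - ((t : ℂ) - Complex.I) ^ 2) ^ 3 := by
  have key : ∀ s : ℝ, (((∑ i : Fin 3, (Function.update x j s i) ^ 2 : ℝ) : ℂ)
      - ((t : ℂ) - Complex.I) ^ 2) =
      ((((∑ i : Fin 3, (x i) ^ 2 : ℝ) : ℂ) - ((t : ℂ) - Complex.I) ^ 2) - (x j : ℂ) ^ 2)
        + 1 * ((s : ℂ) + 0) ^ 2 := by
    intro s
    fin_cases j <;> simp [Fin.sum_univ_three, Function.update] <;> ring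
  rw [pd_pd]
  unfold ftilde
  simp only [key]
  rw [second_deriv _ _ _ (fun s => by rw [← key s]; exact den_ne t _)]
  simp

/-- `f̃(t,x) = 1/(‖x‖² − (t−i)²)` is well defined (the denominator never vanishes)
and satisfies the wave equation `∂²f̃/∂t² = ∑_j ∂²f̃/∂x_j²` on `ℝ × ℝ³`. -/
theorem ftilde_wave_equation :
    (∀ (t : ℝ) (x : Fin 3 → ℝ),
      (((∑ j : Fin 3, (x j) ^ 2 : ℝ) : ℂ) - ((t : ℂ) - Complex.I) ^ 2) ≠ 0) ∧
    (∀ (t : ℝ) (x : Fin 3 → ℝ),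
      pdt (pdt ftilde) t x = ∑ j : Fin 3, pd j (pd j (ftilde t)) x) := by
  refine ⟨den_ne, fun t x => ?_⟩
  have key : ∀ s : ℝ, (((∑ i : Fin 3, (x i) ^ 2 : ℝ) : ℂ) - ((s : ℂ) - Complex.I) ^ 2) =
      ((∑ i : Fin 3, (x i) ^ 2 : ℝ) : ℂ) + (-1) * ((s : ℂ) + (-Complex.I)) ^ 2 := by
    intro s; ring
  have ht : pdt (pdt ftilde) t x = deriv (deriv (fun s : ℝ =>
      1 / (((∑ i : Fin 3, (x i) ^ 2 : ℝ) : ℂ) + (-1) * ((s : ℂ) + (-Complex.I)) ^ 2))) t := by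
    simp only [← key]
    rfl
  rw [ht, second_deriv _ _ _ (fun s => by rw [← key s]; exact den_ne s _), ← key t]
  simp only [space_deriv]
  have h0 := den_ne t x
  have hS : ((∑ i : Fin 3, (x i) ^ 2 : ℝ) : ℂ) = (x 0 : ℂ) ^ 2 + (x 1 : ℂ) ^ 2 + (x 2 : ℂ) ^ 2 := by
    simp [Fin.sum_univ_three]
  rw [hS] at h0 ⊢
  rw [Fin.sum_univ_three]
  generalize hX : (x 0 : ℂ) ^ 2 + (x 1 : ℂ) ^ 2 + (x 2 : ℂ) ^ 2 - ((t : ℂ) - Complex.I) ^ 2 = X at *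
  field_simp
  linear_combination (-8) * hX
end

section
/- Let e : ℝ³ → ℝ^{3×3} be a twice continuously differentiable field of symmetric matrices that is transverse–traceless: ∑_k e_{kk}(x) = 0 and ∑_l ∂_l e_{kl}(x) = 0 for every k and every x ∈ ℝ³. Then the scalar function u(x) = ∑_{k,l} x_k x_l e_{kl}(x) satisfies Δu(x) = ∑_{k,l} x_k x_l (Δe_{kl})(x) for every x ∈ ℝ³, where Δ denotes the Euclidean Laplacian ∑_j ∂²/∂x_j². In particular, if −Δe_{kl} = E_{kl} for a transverse–traceless field E, then a := 2 ∑_{k,l} x_k x_l e_{kl} satisfies −Δa = 2 ∑_{k,l} x_k x_l E_{kl}. -/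
theorem pd_hasDerivAt {f : (Fin 3 → ℝ) → ℝ} (hf : Differentiable ℝ f) (j : Fin 3)
    (x : Fin 3 → ℝ) :
    HasDerivAt (fun s => f (Function.update x j s)) (fderiv ℝ f x (Pi.single j 1)) (x j) := by
  have h1 : HasFDerivAt f (fderiv ℝ f x) (Function.update x j (x j)) := by
    rw [Function.update_eq_self]; exact (hf x).hasFDerivAt
  exact h1.comp_hasDerivAt (x j) (hasDerivAt_update x j (x j))

theorem pd_eq_fderiv {f : (Fin 3 → ℝ) → ℝ} (hf : Differentiable ℝ f) (j : Fin 3) :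
    pd j f = fun x => fderiv ℝ f x (Pi.single j 1) :=
  funext fun x => (pd_hasDerivAt hf j x).deriv

theorem pd_diff {f : (Fin 3 → ℝ) → ℝ} (hf : ContDiff ℝ 2 f) (j : Fin 3) :
    Differentiable ℝ (pd j f) := by
  rw [pd_eq_fderiv (hf.differentiable (by norm_num))]
  have : ContDiff ℝ 1 (fderiv ℝ f) := hf.fderiv_right (by norm_num)
  have := this.differentiable (by norm_num)
  fun_prop

theorem pd_mul' {f g : (Fin 3 → ℝ) → ℝ} (hf : Differentiable ℝ f) (hg : Differentiable ℝ g)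
    (j : Fin 3) :
    pd j (fun y => f y * g y) = fun y => pd j f y * g y + f y * pd j g y := by
  rw [pd_eq_fderiv (hf.fun_mul hg), pd_eq_fderiv hf, pd_eq_fderiv hg]
  funext x
  rw [fderiv_fun_mul (hf x) (hg x)]
  simp
  ring

theorem pd_add' {f g : (Fin 3 → ℝ) → ℝ} (hf : Differentiable ℝ f) (hg : Differentiable ℝ g)
    (j : Fin 3) :
    pd j (fun y => f y + g y) = fun y => pd j f y + pd j g y := by
  rw [pd_eq_fderiv (hf.fun_add hg), pd_eq_fderiv hf, pd_eq_fderiv hg]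
  funext x
  rw [fderiv_fun_add (hf x) (hg x)]
  simp

theorem pd_sum' {ι : Type} (s : Finset ι) {f : ι → (Fin 3 → ℝ) → ℝ}
    (hf : ∀ i, Differentiable ℝ (f i)) (j : Fin 3) :
    pd j (fun y => ∑ i ∈ s, f i y) = fun y => ∑ i ∈ s, pd j (f i) y := by
  funext x
  have := HasDerivAt.fun_sum (u := s) (x := x j)
    (A := fun i t => f i (Function.update x j t)) (fun i _ => pd_hasDerivAt (hf i) j x)
  simp only [pd_eq_fderiv (hf _)]
  exact this.deriv

theorem pd_coord (j k : Fin 3) :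
    pd j (fun y => y k) = fun _ => if k = j then (1 : ℝ) else 0 := by
  rw [pd_eq_fderiv (by fun_prop)]
  funext x
  have : HasFDerivAt (fun y : Fin 3 → ℝ => y k) (ContinuousLinearMap.proj (R := ℝ) k) x :=
    hasFDerivAt_apply k x
  rw [this.fderiv]
  simp [Pi.single_apply]

theorem pd_const' (j : Fin 3) (c : ℝ) : pd j (fun _ => c) = fun _ => 0 := by
  funext x; simp [pd]

theorem pd_cmul (j : Fin 3) (c : ℝ) (f : (Fin 3 → ℝ) → ℝ) :
    pd j (fun y => c * f y) = fun y => c * pd j f y := by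
  funext x; simp [pd]

theorem pd_pd_term {f : (Fin 3 → ℝ) → ℝ} (hf : ContDiff ℝ 2 f) (j k l : Fin 3)
    (x : Fin 3 → ℝ) :
    pd j (pd j (fun y => y k * y l * f y)) x =
      2 * (if k = j then 1 else 0) * (if l = j then 1 else 0) * f x
      + 2 * ((if k = j then 1 else 0) * x l + x k * (if l = j then 1 else 0)) * pd j f x
      + x k * x l * pd j (pd j f) x := by
  have h1 : Differentiable ℝ f := hf.differentiable (by norm_num)
  have h2 := pd_diff hf j
  rw [pd_mul' (by fun_prop) h1, pd_mul' (by fun_prop) (by fun_prop), pd_coord, pd_coord,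
    pd_add' (by fun_prop) (by fun_prop), pd_mul' (by fun_prop) h1, pd_mul' (by fun_prop) h2,
    pd_mul' (by fun_prop) (by fun_prop), pd_add' (by fun_prop) (by fun_prop),
    pd_mul' (by fun_prop) (by fun_prop), pd_mul' (by fun_prop) (by fun_prop), pd_coord, pd_coord,
    pd_const', pd_const']
  ring

/-- If `e` is a `C²` transverse–traceless symmetric matrix field on `ℝ³`, then
`u(x) = ∑_{k,l} x_k x_l e_{kl}(x)` satisfies `Δu(x) = ∑_{k,l} x_k x_l (Δe_{kl})(x)`.
In particular, if `−Δe_{kl} = E_{kl}` for transverse–traceless `E`, then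
`a := 2 ∑_{k,l} x_k x_l e_{kl}` satisfies `−Δa = 2 ∑_{k,l} x_k x_l E_{kl}`. -/
theorem laplacian_quadratic_contraction_TT
    (e : (Fin 3 → ℝ) → Fin 3 → Fin 3 → ℝ)
    (he : ContDiff ℝ 2 e)
    (hsymm : ∀ (x : Fin 3 → ℝ) (k l : Fin 3), e x k l = e x l k)
    (htrace : ∀ x : Fin 3 → ℝ, ∑ k : Fin 3, e x k k = 0)
    (hdiv : ∀ (x : Fin 3 → ℝ) (k : Fin 3), ∑ l : Fin 3, pd l (fun y => e y k l) x = 0) :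
    (∀ x : Fin 3 → ℝ,
      ∑ j : Fin 3, pd j (pd j (fun y => ∑ k : Fin 3, ∑ l : Fin 3, y k * y l * e y k l)) x
        = ∑ k : Fin 3, ∑ l : Fin 3,
            x k * x l * (∑ j : Fin 3, pd j (pd j (fun y => e y k l)) x)) ∧
    (∀ E : (Fin 3 → ℝ) → Fin 3 → Fin 3 → ℝ,
      (∀ (x : Fin 3 → ℝ) (k l : Fin 3),
        -(∑ j : Fin 3, pd j (pd j (fun y => e y k l)) x) = E x k l) →
      ∀ x : Fin 3 → ℝ,
        -(∑ j : Fin 3, pd j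
            (pd j (fun y => 2 * ∑ k : Fin 3, ∑ l : Fin 3, y k * y l * e y k l)) x)
          = 2 * ∑ k : Fin 3, ∑ l : Fin 3, x k * x l * E x k l) := by
  have hc : ∀ k l, ContDiff ℝ 2 (fun y => e y k l) := fun k l =>
    contDiff_pi.1 (contDiff_pi.1 he k) l
  have hd : ∀ k l, Differentiable ℝ (fun y : Fin 3 → ℝ => y k * y l * e y k l) := fun k l => by
    have := (hc k l).differentiable (by norm_num)
    fun_prop
  have ht : ∀ k l, ContDiff ℝ 2 (fun y : Fin 3 → ℝ => y k * y l * e y k l) := fun k l => by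
    have := hc k l
    fun_prop
  have main : ∀ x : Fin 3 → ℝ,
      ∑ j : Fin 3, pd j (pd j (fun y => ∑ k : Fin 3, ∑ l : Fin 3, y k * y l * e y k l)) x
        = ∑ k : Fin 3, ∑ l : Fin 3,
            x k * x l * (∑ j : Fin 3, pd j (pd j (fun y => e y k l)) x) := by
    intro x
    have step : ∀ j : Fin 3,
        pd j (pd j (fun y => ∑ k : Fin 3, ∑ l : Fin 3, y k * y l * e y k l)) x
        = ∑ k : Fin 3, ∑ l : Fin 3, pd j (pd j (fun y => y k * y l * e y k l)) x := by
      intro j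
      rw [pd_sum' _ (fun k => Differentiable.fun_sum fun l _ => hd k l)]
      simp only [pd_sum' _ (hd _)]
      rw [pd_sum' _ (fun k => Differentiable.fun_sum fun l _ => pd_diff (ht k l) j)]
      simp only [pd_sum' _ (fun l => pd_diff (ht _ l) j)]
    simp only [step, pd_pd_term (hc _ _)]
    have s10 : (fun y => e y 1 0) = fun y => e y 0 1 := funext fun y => hsymm y 1 0
    have s20 : (fun y => e y 2 0) = fun y => e y 0 2 := funext fun y => hsymm y 2 0
    have s21 : (fun y => e y 2 1) = fun y => e y 1 2 := funext fun y => hsymm y 2 1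
    have t := htrace x
    have d0 := hdiv x 0
    have d1 := hdiv x 1
    have d2 := hdiv x 2
    simp only [Fin.sum_univ_three, s10, s20, s21] at t d0 d1 d2 ⊢
    simp
    linear_combination 2 * t + 4 * x 0 * d0 + 4 * x 1 * d1 + 4 * x 2 * d2
  refine ⟨main, fun E hE x => ?_⟩
  simp only [pd_cmul, ← Finset.mul_sum, main, ← hE]
  simp only [mul_neg, Finset.sum_neg_distrib]
end

section
/- Let ψ : ℝ × ℝ → ℂ be the time–radius part of the quadrupole hopfion, ψ(t, r) = r² / (r² − (t − i)²)³, and define κ(t, r) = r⁵ · t · (r² + t² + 1) / (((r + t)² + 1)⁴ · ((r − t)² + 1)⁴). Then for all real t and r: ∂/∂r ( r · ψ(t, r) ) · conj( r · ∂ψ/∂t (t, r) ) + conj( ∂/∂r ( r · ψ(t, r) ) ) · ( r · ∂ψ/∂t (t, r) ) = −36 · κ(t, r) (an equality of complex numbers whose left-hand side is real). -/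
/-- Time–radius part of the quadrupole hopfion: `ψ(t,r) = r²/(r² − (t−i)²)³`. -/
noncomputable def psiq (t r : ℝ) : ℂ :=
  (r : ℂ) ^ 2 / ((r : ℂ) ^ 2 - ((t : ℂ) - Complex.I) ^ 2) ^ 3

/-- The profile `κ(t,r)` of the mixed term of the conformal quasi-local electromagnetic
energy density of the quadrupole hopfion. -/
noncomputable def kappaq (t r : ℝ) : ℝ :=
  r ^ 5 * t * (r ^ 2 + t ^ 2 + 1) /
    (((r + t) ^ 2 + 1) ^ 4 * ((r - t) ^ 2 + 1) ^ 4)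

theorem denq_ne (t r : ℝ) : (r : ℂ) ^ 2 - ((t : ℂ) - Complex.I) ^ 2 ≠ 0 := by
  have h : (r : ℂ) ^ 2 - ((t : ℂ) - Complex.I) ^ 2
      = ((r : ℂ) - t + Complex.I) * ((r : ℂ) + t - Complex.I) := by ring
  rw [h]
  refine mul_ne_zero ?_ ?_ <;> intro h0 <;> simpa using congrArg Complex.im h0

theorem deriv_r_q (t r : ℝ) : deriv (fun s : ℝ => (s : ℂ) * psiq t s) r
    = -3 * (r : ℂ) ^ 2 * ((r : ℂ) ^ 2 + ((t : ℂ) - Complex.I) ^ 2)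
      / ((r : ℂ) ^ 2 - ((t : ℂ) - Complex.I) ^ 2) ^ 4 := by
  have hD := denq_ne t r
  have h1 : HasDerivAt (fun s : ℝ => (s : ℂ)) 1 r := Complex.ofRealCLM.hasDerivAt
  have h2 := h1.fun_mul ((h1.fun_pow 2).fun_div
    (((h1.fun_pow 2).sub_const (((t : ℂ) - Complex.I) ^ 2)).fun_pow 3) (pow_ne_zero 3 hD))
  unfold psiq
  rw [h2.deriv]
  field_simp
  push_cast
  ring

theorem deriv_t_q (t r : ℝ) : deriv (fun s : ℝ => psiq s r) t
    = 6 * (r : ℂ) ^ 2 * ((t : ℂ) - Complex.I)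
      / ((r : ℂ) ^ 2 - ((t : ℂ) - Complex.I) ^ 2) ^ 4 := by
  have hD := denq_ne t r
  have h1 : HasDerivAt (fun s : ℝ => (s : ℂ)) 1 t := Complex.ofRealCLM.hasDerivAt
  have h2 := (hasDerivAt_const t ((r : ℂ) ^ 2)).fun_div
    ((((h1.sub_const Complex.I).fun_pow 2).const_sub ((r : ℂ) ^ 2)).fun_pow 3) (pow_ne_zero 3 hD)
  unfold psiq
  rw [h2.deriv]
  field_simp
  push_cast
  ring

/-- Time–radius reduction of the mixed term `F₂` of the quasi-local conformal
electromagnetic energy density of the quadrupole hopfion: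
`∂_r(rψ)·conj(r ∂_t ψ) + conj(∂_r(rψ))·(r ∂_t ψ) = −36 κ(t,r)`. -/
theorem quadrupole_mixed_term_identity (t r : ℝ) :
    deriv (fun s : ℝ => (s : ℂ) * psiq t s) r
        * (starRingEnd ℂ) ((r : ℂ) * deriv (fun s => psiq s r) t)
      + (starRingEnd ℂ) (deriv (fun s : ℝ => (s : ℂ) * psiq t s) r)
        * ((r : ℂ) * deriv (fun s => psiq s r) t)
      = ((-36 * kappaq t r : ℝ) : ℂ) := by
  rw [deriv_r_q, deriv_t_q]
  have hD := denq_ne t r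
  have hE : (r : ℂ) ^ 2 - ((t : ℂ) + Complex.I) ^ 2 ≠ 0 := by
    have := (map_ne_zero (starRingEnd ℂ)).2 hD
    simpa using this
  have hP : (((r : ℂ) + t) ^ 2 + 1) * (((r : ℂ) - t) ^ 2 + 1)
      = ((r : ℂ) ^ 2 - ((t : ℂ) - Complex.I) ^ 2) * ((r : ℂ) ^ 2 - ((t : ℂ) + Complex.I) ^ 2) := by
    linear_combination (2 * (r : ℂ) ^ 2 + 2 * t ^ 2 + Complex.I ^ 2 * (-1) + 1) * Complex.I_sq
  have hz : ((t : ℂ) - Complex.I) * ((t : ℂ) + Complex.I) = t ^ 2 + 1 := by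
    linear_combination -Complex.I_sq
  have hs : ((t : ℂ) - Complex.I) + ((t : ℂ) + Complex.I) = 2 * t := by ring
  unfold kappaq
  push_cast
  rw [← mul_pow, hP]
  simp only [map_mul, map_div₀, map_pow, map_add, map_sub, map_neg, Complex.conj_ofReal,
    Complex.conj_I, map_ofNat, sub_neg_eq_add]
  generalize (t : ℂ) - Complex.I = z at *
  generalize (t : ℂ) + Complex.I = w at *
  have hk : (t : ℂ) * ((r : ℂ) ^ 2 + t ^ 2 + 1) = (z + w) / 2 * (r ^ 2 + z * w) := by
    rw [hz, hs]; ring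
  rw [mul_assoc ((r : ℂ) ^ 5), hk]
  field_simp
  ring
end
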